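/- For every integer n ≥ 1 there exists a constant C > 0 such that the following holds: for every ε > 0, every j ∈ ℤ, and every smooth u : ℝ² → ℝ^{n+1} satisfying −Δu = (1/ε²)(1−|u|²)u on the open annulus Ã_j = B_{2^{-j+1}} \ closure(B_{2^{-j-2}}) with 3/4 ≤ |u| ≤ 1 on Ã_j, there exists ρ ∈ [2^{-j-1}, 2^{-j}] such that for every σ > 0: ∫_{B_{2ρ}\B_{ρ/2}} |Du|² ≤ C ∫_{B_{2ρ}\B_{ρ/2}} |u∧Du|² + Cσ ∫_{Ã_j} |Du|² + (C·2^{2j}/σ) ∫_{Ã_j} (1−|u|²)². -/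

import Mathlib

open MeasureTheory Metric Real

noncomputable section

/-- Euclidean plane. -/
abbrev E2 : Type := EuclideanSpace ℝ (Fin 2)

/-- Partial derivative in the `k`-th coordinate direction. -/
def pd {F : Type} [NormedAddCommGroup F] [NormedSpace ℝ F]
    (k : Fin 2) (f : E2 → F) (x : E2) : F :=
  fderiv ℝ f x (EuclideanSpace.single k 1)

/-- Euclidean Laplacian, acting componentwise. -/
def lap {F : Type} [NormedAddCommGroup F] [NormedSpace ℝ F]
    (f : E2 → F) (x : E2) : F :=
  pd 0 (pd 0 f) x + pd 1 (pd 1 f) x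

/-- Squared Frobenius norm of the total derivative. -/
def gradSqNorm {F : Type} [NormedAddCommGroup F] [NormedSpace ℝ F]
    (f : E2 → F) (x : E2) : ℝ :=
  ∑ k : Fin 2, ‖pd k f x‖ ^ 2

/-- Wedge energy density
`|u∧Du|²(x) = Σ_{k} Σ_{i<j} (u_i ∂_k u_j − u_j ∂_k u_i)²`. -/
def wedgeSq {n : ℕ} (u : E2 → EuclideanSpace ℝ (Fin (n + 1))) (x : E2) : ℝ :=
  ∑ k : Fin 2, ∑ i : Fin (n + 1), ∑ j : Fin (n + 1),
    if i < j then
      (u x i * pd k (fun z => u z j) x - u x j * pd k (fun z => u z i) x) ^ 2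
    else 0

open scoped NNReal ENNReal Topology

theorem st_lip : ∃ M : ℝ≥0, LipschitzWith M Real.smoothTransition := by
  have hc : Continuous (deriv Real.smoothTransition) :=
    (Real.smoothTransition.contDiff (n := 1)).continuous_deriv (by norm_num)
  obtain ⟨K, hK⟩ := (isCompact_Icc (a := (0:ℝ)) (b := 1)).exists_bound_of_continuousOn
    hc.continuousOn
  refine ⟨Real.toNNReal K, ?_⟩
  apply lipschitzWith_of_nnnorm_deriv_le
    ((Real.smoothTransition.contDiff (n := 1)).differentiable (by norm_num))
  intro x
  rw [← NNReal.coe_le_coe, coe_nnnorm]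
  refine le_trans ?_ (Real.le_coe_toNNReal K)
  have hK0 : 0 ≤ K := (norm_nonneg _).trans (hK 0 (by simp))
  by_cases h0 : x < 0
  · have : deriv Real.smoothTransition x = 0 := by
      have : Real.smoothTransition =ᶠ[𝓝 x] fun _ => 0 := by
        filter_upwards [eventually_lt_nhds h0] with y hy
        exact Real.smoothTransition.zero_of_nonpos hy.le
      rw [this.deriv_eq]; simp
    rw [this]; simpa
  by_cases h1 : 1 < x
  · have : deriv Real.smoothTransition x = 0 := by
      have : Real.smoothTransition =ᶠ[𝓝 x] fun _ => 1 := by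
        filter_upwards [eventually_gt_nhds h1] with y hy
        exact Real.smoothTransition.one_of_one_le hy.le
      rw [this.deriv_eq]; simp
    rw [this]; simpa
  exact hK x ⟨not_lt.1 h0, not_lt.1 h1⟩

/-- radial profile -/
def prof (a r : ℝ) : ℝ := Real.smoothTransition (r / a - 1)

theorem prof_contDiff (a : ℝ) : ContDiff ℝ (⊤ : ℕ∞) (prof a) := by
  unfold prof
  exact Real.smoothTransition.contDiff.comp ((contDiff_id.div_const a).sub contDiff_const)

theorem prof_mono {a : ℝ} (ha : 0 < a) : Monotone (prof a) := by
  intro x y h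
  apply Real.smoothTransition.monotone
  gcongr

theorem prof_zero {a r : ℝ} (ha : 0 < a) (h : r ≤ a) : prof a r = 0 := by
  apply Real.smoothTransition.zero_of_nonpos
  rw [sub_nonpos, div_le_one ha]; exact h

theorem prof_one {a r : ℝ} (ha : 0 < a) (h : 2 * a ≤ r) : prof a r = 1 := by
  apply Real.smoothTransition.one_of_one_le
  rw [le_sub_iff_add_le, le_div_iff₀ ha]; linarith

theorem prof_norm_contDiff {a c : ℝ} (ha : 0 < a) (_hc : 0 < c) :
    ContDiff ℝ (⊤ : ℕ∞) (fun x : E2 => prof a (c * ‖x‖)) := by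
  rw [contDiff_iff_contDiffAt]
  intro x
  by_cases hx : x = 0
  · subst hx
    have : (fun x : E2 => prof a (c * ‖x‖)) =ᶠ[𝓝 0] fun _ => 0 := by
      have h : ∀ᶠ y : E2 in 𝓝 0, c * ‖y‖ < a := by
        have hcont : Continuous (fun y : E2 => c * ‖y‖) := by fun_prop
        exact hcont.continuousAt.eventually (eventually_lt_nhds (by simpa))
      filter_upwards [h] with y hy
      exact prof_zero ha hy.le
    exact contDiffAt_const.congr_of_eventuallyEq this
  · exact (prof_contDiff a).contDiffAt.comp x (contDiffAt_const.mul (contDiffAt_norm ℝ hx))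

theorem prof_norm_lip {M : ℝ≥0} (hM : LipschitzWith M Real.smoothTransition) {a c : ℝ}
    (ha : 0 < a) (hc : 0 < c) (x : E2) :
    ‖fderiv ℝ (fun x : E2 => prof a (c * ‖x‖)) x‖ ≤ M * c / a := by
  have hpos : 0 ≤ M * c / a := by positivity
  have : LipschitzWith ⟨M * c / a, hpos⟩ (fun x : E2 => prof a (c * ‖x‖)) := by
    apply LipschitzWith.of_dist_le_mul
    intro x y
    refine (hM.dist_le_mul _ _).trans ?_
    have : dist (c * ‖x‖ / a - 1) (c * ‖y‖ / a - 1) = c / a * |‖x‖ - ‖y‖| := by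
      rw [Real.dist_eq, show c * ‖x‖ / a - 1 - (c * ‖y‖ / a - 1) = c / a * (‖x‖ - ‖y‖) by ring,
        abs_mul, abs_of_pos (by positivity)]
    rw [this, dist_eq_norm x y]
    calc (M:ℝ) * (c / a * |‖x‖ - ‖y‖|) ≤ M * (c / a * ‖x - y‖) := by
          gcongr; exact abs_norm_sub_norm_le x y
      _ = M * c / a * ‖x - y‖ := by ring
  exact norm_fderiv_le_of_lipschitz ℝ this

/-- the averaged cutoff -/
def cut (a : ℝ) (x : E2) : ℝ := prof a (2 * ‖x‖) - prof a (1 / 2 * ‖x‖)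

theorem cut_contDiff {a : ℝ} (ha : 0 < a) : ContDiff ℝ (⊤ : ℕ∞) (cut a) :=
  (prof_norm_contDiff ha (by norm_num)).sub (prof_norm_contDiff ha (by norm_num))

theorem cut_nonneg {a : ℝ} (ha : 0 < a) (x : E2) : 0 ≤ cut a x := by
  unfold cut
  rw [sub_nonneg]
  apply prof_mono ha
  have := norm_nonneg x
  linarith

theorem cut_zero {a : ℝ} (ha : 0 < a) {x : E2}
    (hx : x ∉ ball (0 : E2) (4 * a) \ closedBall (0 : E2) (a / 2)) : cut a x = 0 := by
  simp only [Set.mem_sdiff, mem_ball, dist_zero_right, mem_closedBall, not_and_or, not_lt,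
    not_not] at hx
  unfold cut
  rcases hx with h | h
  · rw [prof_one ha (by linarith), prof_one ha (by linarith)]; simp
  · rw [prof_zero ha (by linarith), prof_zero ha (by linarith)]; simp

theorem cut_fderiv_zero {a : ℝ} (ha : 0 < a) {x : E2}
    (hx : x ∉ ball (0 : E2) (4 * a) \ closedBall (0 : E2) (a / 2)) : fderiv ℝ (cut a) x = 0 := by
  apply IsLocalMin.fderiv_eq_zero
  apply Filter.Eventually.of_forall
  intro y
  rw [cut_zero ha hx]
  exact cut_nonneg ha y

theorem cut_pd_le {M : ℝ≥0} (hM : LipschitzWith M Real.smoothTransition) {a : ℝ}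
    (ha : 0 < a) (k : Fin 2) (x : E2) : |pd k (cut a) x| ≤ 5 / 2 * M / a := by
  have h1 : fderiv ℝ (cut a) x = fderiv ℝ (fun x : E2 => prof a (2 * ‖x‖)) x
      - fderiv ℝ (fun x : E2 => prof a (1 / 2 * ‖x‖)) x := by
    apply fderiv_sub
    · exact (prof_norm_contDiff ha (by norm_num)).differentiable (by simp) x
    · exact (prof_norm_contDiff ha (by norm_num)).differentiable (by simp) x
  have h2 : ‖fderiv ℝ (cut a) x‖ ≤ 5 / 2 * M / a := by
    rw [h1]
    refine (norm_sub_le _ _).trans ?_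
    have e1 := prof_norm_lip hM ha (c := 2) (by norm_num) x
    have e2 := prof_norm_lip hM ha (c := 1 / 2) (by norm_num) x
    calc _ ≤ M * 2 / a + M * (1 / 2) / a := add_le_add e1 e2
      _ = _ := by ring
  unfold pd
  refine ((fderiv ℝ (cut a) x).le_opNorm _).trans ?_
  simpa using h2

theorem cut_hasCompactSupport {a : ℝ} (ha : 0 < a) : HasCompactSupport (cut a) := by
  apply HasCompactSupport.intro (isCompact_closedBall (0 : E2) (4 * a))
  intro x hx
  apply cut_zero ha
  intro h
  exact hx (ball_subset_closedBall h.1)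

theorem exists_radius {a : ℝ} (ha : 0 < a) {f : E2 → ℝ} (hf : Continuous f) :
    ∃ ρ ∈ Set.Icc a (2 * a),
      (∫ x in ball (0 : E2) (2 * ρ) \ ball (0 : E2) (ρ / 2), f x) ≤ ∫ x, cut a x * f x := by
  set φ : ℝ → ℝ := deriv (prof a) with hφ
  have hφc : Continuous φ := (prof_contDiff a).continuous_deriv (by simp)
  have hφ0 : ∀ r, 0 ≤ φ r := fun r => (prof_mono ha).deriv_nonneg
  have hφz : ∀ r, r ∉ Set.Icc a (2 * a) → φ r = 0 := by
    intro r hr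
    rw [Set.mem_Icc, not_and_or, not_le, not_le] at hr
    rcases hr with h | h
    · have : prof a =ᶠ[𝓝 r] fun _ => 0 := by
        filter_upwards [eventually_lt_nhds h] with y hy
        exact prof_zero ha hy.le
      rw [hφ, this.deriv_eq]; simp
    · have : prof a =ᶠ[𝓝 r] fun _ => 1 := by
        filter_upwards [eventually_gt_nhds h] with y hy
        exact prof_one ha hy.le
      rw [hφ, this.deriv_eq]; simp
  have hφi : Integrable φ :=
    hφc.integrable_of_hasCompactSupport (HasCompactSupport.intro isCompact_Icc hφz)
  have hftc : ∀ p q : ℝ, ∫ r in p..q, φ r = prof a q - prof a p := by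
    intro p q
    apply intervalIntegral.integral_deriv_eq_sub
    · intro x _
      exact (prof_contDiff a).differentiable (by simp) x
    · exact hφc.intervalIntegrable _ _
  have hφ1 : ∫ r, φ r = 1 := by
    have h := hftc a (2 * a)
    rw [prof_zero ha le_rfl, prof_one ha le_rfl, intervalIntegral.integral_of_le (by linarith),
      ← integral_Icc_eq_integral_Ioc, setIntegral_eq_integral_of_forall_compl_eq_zero hφz] at h
    simpa using h
  let T : Set (ℝ × E2) := {p | p.1 / 2 ≤ ‖p.2‖ ∧ ‖p.2‖ < 2 * p.1}
  have hT : MeasurableSet T := by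
    have m1 : Measurable (fun p : ℝ × E2 => p.1 / 2) := by fun_prop
    have m2 : Measurable (fun p : ℝ × E2 => ‖p.2‖) := by fun_prop
    have m3 : Measurable (fun p : ℝ × E2 => 2 * p.1) := by fun_prop
    exact (measurableSet_le m1 m2).inter (measurableSet_lt m2 m3)
  let g : ℝ × E2 → ℝ := fun p => φ p.1 * f p.2
  have hg : Continuous g := by fun_prop
  have hG : Integrable (T.indicator g) (volume.prod volume) := by
    let K : Set (ℝ × E2) := Set.Icc a (2 * a) ×ˢ closedBall (0 : E2) (4 * a)
    have hK : IsCompact K := isCompact_Icc.prod (isCompact_closedBall _ _)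
    have e : T.indicator g = T.indicator (K.indicator g) := by
      apply Set.indicator_congr
      rintro ⟨r, x⟩ hp
      by_cases hk : (r, x) ∈ K
      · rw [Set.indicator_of_mem hk]
      · rw [Set.indicator_of_notMem hk]
        have : r ∉ Set.Icc a (2 * a) := by
          intro hr
          apply hk
          refine ⟨hr, ?_⟩
          simp only [mem_closedBall, dist_zero_right]
          have h2 : ‖x‖ < 2 * r := hp.2
          have h3 := hr.2
          linarith
        simp [g, hφz r this]
    rw [e]
    apply Integrable.indicator _ hT
    rw [integrable_indicator_iff hK.measurableSet]
    exact hg.continuousOn.integrableOn_compact hK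
  have hF : ∀ r, ∫ x, T.indicator g (r, x)
      = φ r * ∫ x in ball (0 : E2) (2 * r) \ ball (0 : E2) (r / 2), f x := by
    intro r
    rw [← integral_const_mul, ← integral_indicator (measurableSet_ball.diff measurableSet_ball)]
    congr 1
    ext x
    have : (r, x) ∈ T ↔ x ∈ ball (0 : E2) (2 * r) \ ball (0 : E2) (r / 2) := by
      simp [T, and_comm]
    by_cases h : (r, x) ∈ T
    · rw [Set.indicator_of_mem h, Set.indicator_of_mem (this.1 h)]
    · rw [Set.indicator_of_notMem h, Set.indicator_of_notMem (fun h' => h (this.2 h'))]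
  have hE : ∀ x, ∫ r, T.indicator g (r, x) = cut a x * f x := by
    intro x
    have hx := norm_nonneg x
    have h1 : cut a x = ∫ r in Set.Ioc (1 / 2 * ‖x‖) (2 * ‖x‖), φ r := by
      rw [cut, ← hftc, intervalIntegral.integral_of_le (by linarith)]
    rw [h1, ← integral_mul_const, ← integral_indicator measurableSet_Ioc]
    congr 1
    ext r
    have : (r, x) ∈ T ↔ r ∈ Set.Ioc (1 / 2 * ‖x‖) (2 * ‖x‖) := by
      simp only [T, Set.mem_ofPred_eq, Set.mem_Ioc]
      constructor
      · rintro ⟨h, h'⟩; constructor <;> linarith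
      · rintro ⟨h, h'⟩; constructor <;> linarith
    by_cases h : (r, x) ∈ T
    · rw [Set.indicator_of_mem h, Set.indicator_of_mem (this.1 h)]
    · rw [Set.indicator_of_notMem h, Set.indicator_of_notMem (fun h' => h (this.2 h'))]
  have hswap : ∫ r, φ r * (∫ x in ball (0 : E2) (2 * r) \ ball (0 : E2) (r / 2), f x)
      = ∫ x, cut a x * f x := by
    simp_rw [← hF, ← hE]
    exact integral_integral_swap (f := fun r x => T.indicator g (r, x)) hG
  have hFi : Integrable
      (fun r => φ r * (∫ x in ball (0 : E2) (2 * r) \ ball (0 : E2) (r / 2), f x)) := by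
    have := hG.integral_prod_left
    simpa only [hF] using this
  by_contra! hcon
  set I := ∫ x, cut a x * f x with hI
  set F : ℝ → ℝ := fun r => ∫ x in ball (0 : E2) (2 * r) \ ball (0 : E2) (r / 2), f x with hFdef
  have hint : Integrable (fun r => φ r * (F r - I)) := by
    have := hFi.sub (hφi.mul_const I)
    refine this.congr (Filter.Eventually.of_forall fun r => ?_)
    simp [F]; ring
  have hz : ∫ r, φ r * (F r - I) = 0 := by
    have : ∫ r, φ r * (F r - I) = ∫ r, (φ r * F r - φ r * I) := by
      congr 1; ext r; ring
    rw [this, integral_sub hFi (hφi.mul_const I), integral_mul_const, hφ1, hswap]; ring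
  have hnn : 0 ≤ fun r => φ r * (F r - I) := by
    intro r
    by_cases hr : r ∈ Set.Icc a (2 * a)
    · exact mul_nonneg (hφ0 r) (sub_nonneg.2 (hcon r hr).le)
    · simp [hφz r hr]
  rw [integral_eq_zero_iff_of_nonneg hnn hint] at hz
  have hae : φ =ᵐ[volume] 0 := by
    filter_upwards [hz] with r hr
    by_cases hr' : r ∈ Set.Icc a (2 * a)
    · rcases mul_eq_zero.1 hr with h | h
      · exact h
      · exact absurd (sub_eq_zero.1 h) (hcon r hr').ne'
    · exact hφz r hr'
  rw [integral_congr_ae hae] at hφ1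
  simp at hφ1

theorem integral_pd_zero (k : Fin 2) {G : E2 → ℝ} (hG : ContDiff ℝ 1 G)
    (hs : HasCompactSupport G) : Integrable (pd k G) ∧ ∫ x, pd k G x = 0 := by
  have hc : Continuous (pd k G) := (hG.continuous_fderiv (by norm_num)).clm_apply continuous_const
  have hs' : HasCompactSupport (pd k G) := by
    exact hs.fderiv_apply ℝ _
  have hi : Integrable (pd k G) := hc.integrable_of_hasCompactSupport hs'
  refine ⟨hi, ?_⟩
  have := integral_mul_fderiv_eq_neg_fderiv_mul_of_integrable (μ := (volume : Measure E2))
    (f := fun _ : E2 => (1:ℝ)) (g := G) (v := EuclideanSpace.single k 1)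
    (by simp) (by simp only [one_mul]; exact hi)
    (by simpa using hG.continuous.integrable_of_hasCompactSupport hs)
    (fun x _ => by fun_prop) (fun x _ => hG.differentiable (by norm_num) x)
  simp only [one_mul, fderiv_fun_const, Pi.zero_apply, zero_apply, zero_mul, integral_zero,
    neg_zero] at this
  exact this

theorem pd_contDiff {F : Type} [NormedAddCommGroup F] [NormedSpace ℝ F] (k : Fin 2) {f : E2 → F}
    (hf : ContDiff ℝ (⊤ : ℕ∞) f) : ContDiff ℝ (⊤ : ℕ∞) (pd k f) := by
  unfold pd
  exact (hf.fderiv_right (m := (⊤ : ℕ∞)) (by simp)).clm_apply contDiff_const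

theorem pd_inner' {F : Type} [NormedAddCommGroup F] [InnerProductSpace ℝ F] (k : Fin 2)
    {f g : E2 → F} (hf : ContDiff ℝ (⊤ : ℕ∞) f) (hg : ContDiff ℝ (⊤ : ℕ∞) g) (x : E2) :
    pd k (fun y => inner ℝ (f y) (g y)) x
      = inner ℝ (f x) (pd k g x) + inner ℝ (pd k f x) (g x) :=
  fderiv_inner_apply ℝ (hf.differentiable (by simp) x) (hg.differentiable (by simp) x) _

theorem pd_mul' (k : Fin 2) {f g : E2 → ℝ} (hf : ContDiff ℝ (⊤ : ℕ∞) f)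
    (hg : ContDiff ℝ (⊤ : ℕ∞) g) (x : E2) :
    pd k (fun y => f y * g y) x = f x * pd k g x + pd k f x * g x := by
  unfold pd
  have := fderiv_fun_mul (hf.differentiable (by simp) x) (hg.differentiable (by simp) x)
  rw [this]
  simp; ring

theorem lagrange_aux {n : ℕ} (u v : EuclideanSpace ℝ (Fin n)) :
    ‖u‖ ^ 2 * ‖v‖ ^ 2 = (∑ i : Fin n, ∑ j : Fin n,
      if i < j then (u i * v j - u j * v i) ^ 2 else 0) + (inner ℝ u v) ^ 2 := by
  have hu : ‖u‖ ^ 2 = ∑ i, u i * u i := by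
    rw [EuclideanSpace.real_norm_sq_eq]; simp [sq]
  have hv : ‖v‖ ^ 2 = ∑ i, v i * v i := by
    rw [EuclideanSpace.real_norm_sq_eq]; simp [sq]
  have hi : inner ℝ u v = ∑ i, u i * v i := by
    simp [PiLp.inner_apply, mul_comm]
  have h1 : ∑ i : Fin n, ∑ j : Fin n, (u i * v j - u j * v i) ^ 2
      = 2 * (‖u‖ ^ 2 * ‖v‖ ^ 2) - 2 * (inner ℝ u v) ^ 2 := by
    have e1 : ‖u‖ ^ 2 * ‖v‖ ^ 2 = ∑ i, ∑ j, (u i * u i) * (v j * v j) := by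
      rw [hu, hv, Finset.sum_mul_sum]
    have e2 : ‖u‖ ^ 2 * ‖v‖ ^ 2 = ∑ i, ∑ j, (u j * u j) * (v i * v i) := by
      rw [e1, Finset.sum_comm]
    have e3 : (inner ℝ u v) ^ 2 = ∑ i, ∑ j, (u i * v i) * (u j * v j) := by
      rw [sq, hi, Finset.sum_mul_sum]
    calc _ = ∑ i, ∑ j, ((u i * u i) * (v j * v j) + (u j * u j) * (v i * v i)
          - 2 * ((u i * v i) * (u j * v j))) := by
          refine Finset.sum_congr rfl fun i _ => Finset.sum_congr rfl fun j _ => ?_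
          ring
      _ = _ := by
          simp only [Finset.sum_sub_distrib, Finset.sum_add_distrib, ← Finset.mul_sum]
          simp only [Finset.mul_sum]
          rw [← e1, ← e2]
          simp only [← Finset.mul_sum]
          rw [e3]
          simp only [← Finset.mul_sum]
          ring
  have h2 : ∑ i : Fin n, ∑ j : Fin n, (u i * v j - u j * v i) ^ 2
      = (∑ i : Fin n, ∑ j : Fin n, if i < j then (u i * v j - u j * v i) ^ 2 else 0)
        + ∑ i : Fin n, ∑ j : Fin n, if j < i then (u j * v i - u i * v j) ^ 2 else 0 := by
    simp only [← Finset.sum_add_distrib]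
    refine Finset.sum_congr rfl fun i _ => Finset.sum_congr rfl fun j _ => ?_
    rcases lt_trichotomy i j with h | h | h
    · simp [h, h.not_gt]
    · subst h; simp
    · simp [h, h.not_gt]; ring
  rw [Finset.sum_comm (f := fun i j => if j < i then (u j * v i - u i * v j) ^ 2 else 0)] at h2
  linarith

theorem pd_apply {n : ℕ} {u : E2 → EuclideanSpace ℝ (Fin n)}
    (hu : ContDiff ℝ (⊤ : ℕ∞) u) (k : Fin 2) (j : Fin n) (x : E2) :
    pd k (fun z => u z j) x = pd k u x j := by
  unfold pd
  have h := (hu.differentiable (by simp) x).hasFDerivAt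
  have h2 := (EuclideanSpace.proj (𝕜 := ℝ) j).hasFDerivAt.comp x h
  have : fderiv ℝ (fun z => u z j) x = (EuclideanSpace.proj (𝕜 := ℝ) j).comp (fderiv ℝ u x) :=
    h2.fderiv
  rw [this]; simp

theorem wedge_eq {n : ℕ} {u : E2 → EuclideanSpace ℝ (Fin (n + 1))}
    (hu : ContDiff ℝ (⊤ : ℕ∞) u) (x : E2) :
    ‖u x‖ ^ 2 * gradSqNorm u x = wedgeSq u x + ∑ k : Fin 2, (inner ℝ (u x) (pd k u x)) ^ 2 := by
  unfold gradSqNorm wedgeSq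
  rw [Finset.mul_sum, ← Finset.sum_add_distrib]
  refine Finset.sum_congr rfl fun k _ => ?_
  simp only [pd_apply hu]
  exact lagrange_aux _ _

theorem gradSq_cont {n : ℕ} {u : E2 → EuclideanSpace ℝ (Fin (n + 1))}
    (hu : ContDiff ℝ (⊤ : ℕ∞) u) : Continuous (gradSqNorm u) := by
  unfold gradSqNorm
  have := fun k => (pd_contDiff k hu).continuous
  fun_prop

theorem wedge_cont {n : ℕ} {u : E2 → EuclideanSpace ℝ (Fin (n + 1))}
    (hu : ContDiff ℝ (⊤ : ℕ∞) u) : Continuous (wedgeSq u) := by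
  have : wedgeSq u = fun x => ‖u x‖ ^ 2 * gradSqNorm u x
      - ∑ k : Fin 2, (inner ℝ (u x) (pd k u x)) ^ 2 := by
    ext x; rw [wedge_eq hu]; ring
  rw [this]
  have h1 := fun k => (pd_contDiff k hu).continuous
  have h2 := gradSq_cont hu
  have h3 := hu.continuous
  fun_prop

theorem cont_integrableOn {f : E2 → ℝ} (hf : Continuous f) (r : ℝ) {s : Set E2}
    (hs : s ⊆ closedBall 0 r) : IntegrableOn f s :=
  (hf.continuousOn.integrableOn_compact (isCompact_closedBall 0 r)).mono_set hs

/-- the defect `1 - |u|²` -/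
def dfc {n : ℕ} (u : E2 → EuclideanSpace ℝ (Fin (n + 1))) (x : E2) : ℝ := 1 - ‖u x‖ ^ 2

theorem dfc_contDiff {n : ℕ} {u : E2 → EuclideanSpace ℝ (Fin (n + 1))}
    (hu : ContDiff ℝ (⊤ : ℕ∞) u) : ContDiff ℝ (⊤ : ℕ∞) (dfc u) :=
  contDiff_const.sub (hu.norm_sq ℝ)

theorem pd_dfc {n : ℕ} {u : E2 → EuclideanSpace ℝ (Fin (n + 1))}
    (hu : ContDiff ℝ (⊤ : ℕ∞) u) (k : Fin 2) :
    pd k (dfc u) = fun x => -2 * inner ℝ (u x) (pd k u x) := by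
  ext x
  have e : dfc u = fun y => 1 - inner ℝ (u y) (u y) := by
    ext y; simp [dfc]
  have h := pd_inner' k hu hu x
  unfold pd at h ⊢
  rw [e, fderiv_const_sub]
  rw [neg_apply, h, real_inner_comm (u x)]; ring

theorem pd_pd_dfc {n : ℕ} {u : E2 → EuclideanSpace ℝ (Fin (n + 1))}
    (hu : ContDiff ℝ (⊤ : ℕ∞) u) (k : Fin 2) (x : E2) :
    pd k (pd k (dfc u)) x = -2 * (inner ℝ (u x) (pd k (pd k u) x) + ‖pd k u x‖ ^ 2) := by
  rw [pd_dfc hu, pd_mul' k contDiff_const (hu.inner ℝ (pd_contDiff k hu)),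
    pd_inner' k hu (pd_contDiff k hu)]
  simp [pd]

/-- the vector field used in the integration by parts -/
theorem field_div {n : ℕ} {u : E2 → EuclideanSpace ℝ (Fin (n + 1))}
    (hu : ContDiff ℝ (⊤ : ℕ∞) u) {a : ℝ} (ha : 0 < a) (k : Fin 2) (x : E2) :
    pd k (fun y => cut a y * (dfc u y * pd k (dfc u) y)) x
      = cut a x * (4 * (inner ℝ (u x) (pd k u x)) ^ 2
          - 2 * dfc u x * (inner ℝ (u x) (pd k (pd k u) x) + ‖pd k u x‖ ^ 2))
        - 2 * pd k (cut a) x * dfc u x * inner ℝ (u x) (pd k u x) := by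
  have hd := dfc_contDiff hu
  rw [pd_mul' k (cut_contDiff ha) (hd.mul (pd_contDiff k hd)), pd_mul' k hd (pd_contDiff k hd),
    pd_pd_dfc hu, pd_dfc hu]
  ring

theorem wedge_nonneg {n : ℕ} (u : E2 → EuclideanSpace ℝ (Fin (n + 1))) (x : E2) :
    0 ≤ wedgeSq u x := by
  unfold wedgeSq
  refine Finset.sum_nonneg fun k _ => Finset.sum_nonneg fun i _ => Finset.sum_nonneg fun j _ => ?_
  split_ifs
  · exact sq_nonneg _
  · exact le_rfl

theorem grad_nonneg {n : ℕ} (u : E2 → EuclideanSpace ℝ (Fin (n + 1))) (x : E2) :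
    0 ≤ gradSqNorm u x :=
  Finset.sum_nonneg fun k _ => sq_nonneg _

/-- Young-type bound of the cutoff term. -/
theorem young_aux {w d i v m a σ : ℝ} (ha : 0 < a) (hσ : 0 < σ) (hw : 0 ≤ w)
    (hd : |d| ≤ 5 / 2 * m / a) (hi : |i| ≤ v) (hm : 0 ≤ m) :
    1 / 2 * (d * w * i) ≤ 5 / 8 * m * (σ * v ^ 2 + 1 / (a ^ 2 * σ) * w ^ 2) := by
  have hv : 0 ≤ v := (abs_nonneg i).trans hi
  have h1 : d * w * i ≤ (5 / 2 * m / a) * w * v := by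
    calc d * w * i ≤ |d * w * i| := le_abs_self _
      _ = |d| * w * |i| := by rw [abs_mul, abs_mul, abs_of_nonneg hw]
      _ ≤ _ := by gcongr
  have h2 : 2 * (w * v / a) ≤ σ * v ^ 2 + 1 / (a ^ 2 * σ) * w ^ 2 := by
    have : σ * v ^ 2 + 1 / (a ^ 2 * σ) * w ^ 2 - 2 * (w * v / a)
        = (σ * v - w / a) ^ 2 / σ := by
      field_simp; ring
    have h3 : 0 ≤ (σ * v - w / a) ^ 2 / σ := by positivity
    linarith
  calc 1 / 2 * (d * w * i) ≤ 1 / 2 * ((5 / 2 * m / a) * w * v) := by gcongr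
    _ = 5 / 8 * m * (2 * (w * v / a)) := by ring
    _ ≤ _ := by gcongr

theorem pointwise {n : ℕ} {M : ℝ≥0} (hM : LipschitzWith M Real.smoothTransition)
    {ε : ℝ} {a : ℝ} (ha : 0 < a) {u : E2 → EuclideanSpace ℝ (Fin (n + 1))}
    (hu : ContDiff ℝ (⊤ : ℕ∞) u) {x : E2}
    (hpde : -lap u x = ((1 / ε ^ 2) * (1 - ‖u x‖ ^ 2)) • u x)
    (hbd : 3 / 4 ≤ ‖u x‖ ∧ ‖u x‖ ≤ 1) {σ : ℝ} (hσ : 0 < σ) :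
    cut a x * (11 / 32 * gradSqNorm u x - wedgeSq u x)
      ≤ 1 / 4 * (pd 0 (fun y => cut a y * (dfc u y * pd 0 (dfc u) y)) x
          + pd 1 (fun y => cut a y * (dfc u y * pd 1 (dfc u) y)) x)
        + 5 / 8 * M * (σ * gradSqNorm u x + 2 / (a ^ 2 * σ) * (1 - ‖u x‖ ^ 2) ^ 2) := by
  have hW := wedge_eq hu x
  have hg0 := grad_nonneg u x
  have hη := cut_nonneg ha x
  rw [field_div hu ha, field_div hu ha]
  have hlap : inner ℝ (u x) (pd 0 (pd 0 u) x) + inner ℝ (u x) (pd 1 (pd 1 u) x)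
      = - ((1 / ε ^ 2) * (1 - ‖u x‖ ^ 2) * ‖u x‖ ^ 2) := by
    rw [← inner_add_right]
    have : pd 0 (pd 0 u) x + pd 1 (pd 1 u) x = -(((1 / ε ^ 2) * (1 - ‖u x‖ ^ 2)) • u x) := by
      rw [← hpde]; simp [lap]
    rw [this, inner_neg_right, inner_smul_right, real_inner_self_eq_norm_sq]
  have hI : ∀ k, |inner ℝ (u x) (pd k u x)| ≤ ‖pd k u x‖ := by
    intro k
    refine (abs_real_inner_le_norm _ _).trans ?_
    calc ‖u x‖ * ‖pd k u x‖ ≤ 1 * ‖pd k u x‖ := by gcongr; exact hbd.2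
      _ = _ := one_mul _
  have hN1 : 9 / 16 ≤ ‖u x‖ ^ 2 := by nlinarith [hbd.1]
  have hN2 : ‖u x‖ ^ 2 ≤ 1 := by nlinarith [hbd.1, hbd.2]
  have hw0 : 0 ≤ dfc u x := by unfold dfc; linarith
  have y0 := young_aux ha hσ hw0 (cut_pd_le hM ha 0 x) (hI 0) M.2
  have y1 := young_aux ha hσ hw0 (cut_pd_le hM ha 1 x) (hI 1) M.2
  have hE : 0 ≤ (1 / ε ^ 2) := by positivity
  have hgr : gradSqNorm u x = ‖pd 0 u x‖ ^ 2 + ‖pd 1 u x‖ ^ 2 := by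
    simp [gradSqNorm]
  rw [Fin.sum_univ_two] at hW
  have hwd : 1 - ‖u x‖ ^ 2 = dfc u x := rfl
  have hNd : ‖u x‖ ^ 2 = 1 - dfc u x := by unfold dfc; ring
  rw [hwd] at hlap ⊢
  rw [hNd] at hlap hN1 hN2 hW
  generalize dfc u x = w at *
  generalize (inner ℝ (u x) (pd 0 (pd 0 u) x) : ℝ) = l0 at *
  generalize (inner ℝ (u x) (pd 1 (pd 1 u) x) : ℝ) = l1 at *
  generalize (inner ℝ (u x) (pd 0 u x) : ℝ) = i0 at *
  generalize (inner ℝ (u x) (pd 1 u x) : ℝ) = i1 at *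
  generalize pd 0 (cut a) x = d0 at *
  generalize pd 1 (cut a) x = d1 at *
  generalize cut a x = η at *
  generalize (1 / ε ^ 2) = E at *
  generalize wedgeSq u x = W at *
  have hmain : 11 / 32 * gradSqNorm u x - W
      ≤ i0 ^ 2 + i1 ^ 2 - 1 / 2 * w * (l0 + l1 + gradSqNorm u x) := by
    rw [hlap]
    have t1 : 0 ≤ (7 / 16 - w) * gradSqNorm u x := mul_nonneg (by linarith) hg0
    have t2 : 0 ≤ w * (E * w * (1 - w)) := by
      have : 0 ≤ 1 - w := by linarith
      positivity
    nlinarith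
  have hm2 := mul_le_mul_of_nonneg_left hmain hη
  rw [hgr] at hm2 ⊢
  have z : (5 / 8 * (M:ℝ) * (σ * (‖pd 0 u x‖ ^ 2 + ‖pd 1 u x‖ ^ 2) + 2 / (a ^ 2 * σ) * w ^ 2))
      = 5 / 8 * M * (σ * ‖pd 0 u x‖ ^ 2 + 1 / (a ^ 2 * σ) * w ^ 2)
        + 5 / 8 * M * (σ * ‖pd 1 u x‖ ^ 2 + 1 / (a ^ 2 * σ) * w ^ 2) := by ring
  rw [z]
  refine hm2.trans ?_
  refine le_trans (le_of_eq ?_) (add_le_add le_rfl (add_le_add y0 y1))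
  ring

theorem core {n : ℕ} {M : ℝ≥0} (hM : LipschitzWith M Real.smoothTransition)
    {ε : ℝ} (_hε : 0 < ε) {a : ℝ} (ha : 0 < a) {u : E2 → EuclideanSpace ℝ (Fin (n + 1))}
    (hu : ContDiff ℝ (⊤ : ℕ∞) u)
    (hpde : ∀ x ∈ ball (0 : E2) (4 * a) \ closedBall (0 : E2) (a / 2),
      -lap u x = ((1 / ε ^ 2) * (1 - ‖u x‖ ^ 2)) • u x)
    (hbd : ∀ x ∈ ball (0 : E2) (4 * a) \ closedBall (0 : E2) (a / 2),
      3 / 4 ≤ ‖u x‖ ∧ ‖u x‖ ≤ 1) {σ : ℝ} (hσ : 0 < σ) :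
    (∫ x, cut a x * (11 / 32 * gradSqNorm u x - wedgeSq u x))
      ≤ 5 / 8 * M * (σ * (∫ x in ball (0 : E2) (4 * a) \ closedBall (0 : E2) (a / 2),
          gradSqNorm u x)
        + 2 / (a ^ 2 * σ) * ∫ x in ball (0 : E2) (4 * a) \ closedBall (0 : E2) (a / 2),
          (1 - ‖u x‖ ^ 2) ^ 2) := by
  set A : Set E2 := ball (0 : E2) (4 * a) \ closedBall (0 : E2) (a / 2) with hA
  have hAm : MeasurableSet A := measurableSet_ball.diff measurableSet_closedBall
  have hAs : A ⊆ closedBall 0 (4 * a) := Set.sdiff_subset.trans ball_subset_closedBall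
  have hd := dfc_contDiff hu
  have hgc := gradSq_cont hu
  have hwc := wedge_cont hu
  have huc := hu.continuous
  have hG : ∀ k : Fin 2, ContDiff ℝ 1 (fun y => cut a y * (dfc u y * pd k (dfc u) y)) := by
    intro k
    exact ((cut_contDiff ha).mul (hd.mul (pd_contDiff k hd))).of_le (by simp)
  have hGs : ∀ k : Fin 2, HasCompactSupport (fun y => cut a y * (dfc u y * pd k (dfc u) y)) := by
    intro k
    exact (cut_hasCompactSupport ha).mul_right
  have h0 := integral_pd_zero 0 (hG 0) (hGs 0)
  have h1 := integral_pd_zero 1 (hG 1) (hGs 1)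
  let R : E2 → ℝ := fun x =>
    5 / 8 * M * (σ * gradSqNorm u x + 2 / (a ^ 2 * σ) * (1 - ‖u x‖ ^ 2) ^ 2)
  have hRc : Continuous R := by fun_prop
  have hRi : Integrable (A.indicator R) :=
    (integrable_indicator_iff hAm).2 (cont_integrableOn hRc _ hAs)
  have hL : Integrable (fun x => cut a x * (11 / 32 * gradSqNorm u x - wedgeSq u x)) := by
    have hcc := (cut_contDiff ha).continuous
    apply Continuous.integrable_of_hasCompactSupport (by fun_prop)
    exact (cut_hasCompactSupport ha).mul_right
  have hDi : Integrable (fun x => 1 / 4 * (pd 0 (fun y => cut a y * (dfc u y * pd 0 (dfc u) y)) x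
          + pd 1 (fun y => cut a y * (dfc u y * pd 1 (dfc u) y)) x)) :=
    (h0.1.add h1.1).const_mul _
  have hmono : (∫ x, cut a x * (11 / 32 * gradSqNorm u x - wedgeSq u x))
      ≤ ∫ x, (1 / 4 * (pd 0 (fun y => cut a y * (dfc u y * pd 0 (dfc u) y)) x
          + pd 1 (fun y => cut a y * (dfc u y * pd 1 (dfc u) y)) x) + A.indicator R x) := by
    apply integral_mono hL (hDi.add hRi)
    intro x
    by_cases hx : x ∈ A
    · simp only [Pi.add_apply, Set.indicator_of_mem hx]
      exact pointwise hM ha hu (hpde x hx) (hbd x hx) hσ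
    · simp only [Pi.add_apply, Set.indicator_of_notMem hx]
      rw [field_div hu ha, field_div hu ha]
      simp [cut_zero ha hx, pd, cut_fderiv_zero ha hx]
  refine hmono.trans (le_of_eq ?_)
  rw [integral_add hDi hRi, integral_const_mul, integral_add h0.1 h1.1, h0.2, h1.2,
    integral_indicator hAm]
  simp only [R]
  rw [integral_const_mul, integral_add, integral_const_mul, integral_const_mul]
  · ring
  · exact (cont_integrableOn hgc _ hAs).const_mul _
  · have : Continuous (fun x => (1 - ‖u x‖ ^ 2) ^ 2) := by fun_prop
    exact (cont_integrableOn this _ hAs).const_mul _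

/-- improved `L²` estimate on dyadic annuli in the neck region
(Lemma 2.7 of the paper). -/
theorem ginzburg_landau_improved_L2_on_dyadic_annuli
    (n : ℕ) (hn : 1 ≤ n) :
    ∃ C > (0 : ℝ),
      ∀ (ε : ℝ), 0 < ε → ∀ (j : ℤ),
      ∀ (u : E2 → EuclideanSpace ℝ (Fin (n + 1))),
        ContDiff ℝ (⊤ : ℕ∞) u →
        (∀ x ∈ ball (0 : E2) ((2:ℝ) ^ (-j + 1)) \ closedBall (0 : E2) ((2:ℝ) ^ (-j - 2)),
          -lap u x = ((1 / ε ^ 2) * (1 - ‖u x‖ ^ 2)) • u x) →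
        (∀ x ∈ ball (0 : E2) ((2:ℝ) ^ (-j + 1)) \ closedBall (0 : E2) ((2:ℝ) ^ (-j - 2)),
          3 / 4 ≤ ‖u x‖ ∧ ‖u x‖ ≤ 1) →
        ∃ ρ ∈ Set.Icc ((2:ℝ) ^ (-j - 1)) ((2:ℝ) ^ (-j)),
          ∀ σ : ℝ, 0 < σ →
            (∫ x in ball (0 : E2) (2 * ρ) \ ball (0 : E2) (ρ / 2), gradSqNorm u x)
              ≤ C * (∫ x in ball (0 : E2) (2 * ρ) \ ball (0 : E2) (ρ / 2), wedgeSq u x)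
                + C * σ *
                    (∫ x in ball (0 : E2) ((2:ℝ) ^ (-j + 1)) \
                        closedBall (0 : E2) ((2:ℝ) ^ (-j - 2)), gradSqNorm u x)
                + (C * (2:ℝ) ^ (2 * j) / σ) *
                    (∫ x in ball (0 : E2) ((2:ℝ) ^ (-j + 1)) \
                        closedBall (0 : E2) ((2:ℝ) ^ (-j - 2)), (1 - ‖u x‖ ^ 2) ^ 2) := by
  obtain ⟨M, hM⟩ := st_lip
  refine ⟨3 + 20 * M, by positivity, ?_⟩
  intro ε hε j u hu hpde hbd
  have h2 : (2:ℝ) ≠ 0 := by norm_num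
  set a : ℝ := (2:ℝ) ^ (-j - 1) with ha_def
  have ha : 0 < a := by positivity
  have e4 : (2:ℝ) ^ (-j + 1) = 4 * a := by
    rw [ha_def, zpow_sub₀ h2, zpow_add₀ h2]; norm_num; ring
  have e1 : (2:ℝ) ^ (-j - 2) = a / 2 := by
    rw [ha_def, zpow_sub₀ h2, zpow_sub₀ h2]; norm_num; ring
  have e2 : (2:ℝ) ^ (-j) = 2 * a := by
    rw [ha_def, zpow_sub₀ h2]; norm_num; ring
  have e3 : (2:ℝ) ^ (2 * j) = 1 / (4 * a ^ 2) := by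
    have hh : (2:ℝ) ^ (2 * j) = ((2:ℝ) ^ j) ^ 2 := by
      rw [← zpow_natCast, ← zpow_mul]; congr 1; push_cast; ring
    have h4 : (2:ℝ) ^ j * (2 * a) = 1 := by
      rw [← e2, ← zpow_add₀ h2]; simp
    rw [hh, eq_div_iff (by positivity)]
    calc _ = ((2:ℝ) ^ j * (2 * a)) ^ 2 := by ring
      _ = 1 := by rw [h4]; norm_num
  rw [e4, e1] at hpde hbd ⊢
  rw [e2, e3]
  have hf : Continuous (fun x => 11 / 32 * gradSqNorm u x - wedgeSq u x) := by
    have := gradSq_cont hu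
    have := wedge_cont hu
    fun_prop
  obtain ⟨ρ, hρ, hle⟩ := exists_radius ha hf
  refine ⟨ρ, hρ, fun σ hσ => ?_⟩
  have hcore := hle.trans (core hM hε ha hu hpde hbd hσ)
  have hsub : ball (0 : E2) (2 * ρ) \ ball (0 : E2) (ρ / 2) ⊆ closedBall 0 (2 * ρ) :=
    Set.sdiff_subset.trans ball_subset_closedBall
  rw [integral_sub ((cont_integrableOn (gradSq_cont hu) _ hsub).const_mul _)
    (cont_integrableOn (wedge_cont hu) _ hsub), integral_const_mul] at hcore
  have hW : 0 ≤ ∫ x in ball (0 : E2) (2 * ρ) \ ball (0 : E2) (ρ / 2), wedgeSq u x :=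
    integral_nonneg fun x => wedge_nonneg u x
  have hg : 0 ≤ ∫ x in ball (0 : E2) (4 * a) \ closedBall (0 : E2) (a / 2), gradSqNorm u x :=
    integral_nonneg fun x => grad_nonneg u x
  have hw : 0 ≤ ∫ x in ball (0 : E2) (4 * a) \ closedBall (0 : E2) (a / 2),
      (1 - ‖u x‖ ^ 2) ^ 2 := integral_nonneg fun x => sq_nonneg _
  have hM0 : (0:ℝ) ≤ M := M.2
  generalize (∫ x in ball (0 : E2) (2 * ρ) \ ball (0 : E2) (ρ / 2), wedgeSq u x) = W at *
  generalize (∫ x in ball (0 : E2) (2 * ρ) \ ball (0 : E2) (ρ / 2), gradSqNorm u x) = G at *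
  generalize (∫ x in ball (0 : E2) (4 * a) \ closedBall (0 : E2) (a / 2), gradSqNorm u x)
    = GA at *
  generalize (∫ x in ball (0 : E2) (4 * a) \ closedBall (0 : E2) (a / 2),
      (1 - ‖u x‖ ^ 2) ^ 2) = V at *
  have p1 : 0 ≤ σ * GA := by positivity
  have p2 : 0 ≤ V / (a ^ 2 * σ) := by positivity
  have q1 : 5 / 8 * M * (σ * GA + 2 / (a ^ 2 * σ) * V)
      = 5 / 8 * (M * (σ * GA)) + 5 / 4 * (M * (V / (a ^ 2 * σ))) := by ring
  have q2 : (3 + 20 * M) * (1 / (4 * a ^ 2)) / σ * V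
      = 3 / 4 * (V / (a ^ 2 * σ)) + 5 * (M * (V / (a ^ 2 * σ))) := by
    field_simp; ring
  rw [q1] at hcore
  rw [q2]
  have r1 : 0 ≤ M * (σ * GA) := by positivity
  have r2 : 0 ≤ M * (V / (a ^ 2 * σ)) := by positivity
  have r3 : 0 ≤ M * W := by positivity
  nlinarith
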